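/- arXiv:2101.06026 — 3 statements merged into one kernel-verified Lean document; each statement's English description precedes it below -/
import Mathlib

section
/- For all integers n ≥ 1 and 0 < k ≤ n, the following polynomial identity in ℤ[q,t] holds: Σ_{σ ∈ A(n,k)} q^{inv(σ)} t^{lmax(σ)} = (t + [k+1]_q − 1)^{n−k} · Π_{i=1}^{k} (t + [i]_q − 1). -/
attribute [local instance] Classical.propDecidable

/-- The maximum drop size of a permutation (0-indexed positions and values). -/
def maxdrop {n : ℕ} (π : Equiv.Perm (Fin n)) : ℕ :=
  Finset.univ.sup fun i : Fin n => (i : ℕ) - (π i : ℕ)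

/-- `A(n,k)`: permutations of `[n]` with maximum drop size at most `k`. -/
def bddA (n k : ℕ) : Finset (Equiv.Perm (Fin n)) :=
  Finset.univ.filter fun π => maxdrop π ≤ k

/-- `S(n,k)`: permutations of `[n]` with `σ i - i ≤ k` for all `i`. -/
def bddS (n k : ℕ) : Finset (Equiv.Perm (Fin n)) :=
  Finset.univ.filter fun π => ∀ i : Fin n, (π i : ℕ) ≤ (i : ℕ) + k

/-- The number of inversions of a permutation. -/
def invStat {n : ℕ} (π : Equiv.Perm (Fin n)) : ℕ :=
  (Finset.univ.filter fun p : Fin n × Fin n => p.1 < p.2 ∧ π p.2 < π p.1).card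

/-- The number of left-to-right maxima of a permutation. -/
def lmaxStat {n : ℕ} (π : Equiv.Perm (Fin n)) : ℕ :=
  (Finset.univ.filter fun i : Fin n => ∀ j, j < i → π j < π i).card

/-- The number of cycles of a permutation, fixed points included. -/
def cycStat {n : ℕ} (π : Equiv.Perm (Fin n)) : ℕ :=
  π.cycleType.card + (Finset.univ.filter fun i => π i = i).card

/-- The sorting index: `σ` has a unique factorization
`σ = (i₁,j₁)(i₂,j₂)⋯(iₘ,jₘ)` into transpositions with `j₁ < j₂ < ⋯ < jₘ` and
`iᵣ < jᵣ` for all `r`, and `sor σ = Σᵣ (jᵣ - iᵣ)`. -/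
noncomputable def sorStat {n : ℕ} (σ : Equiv.Perm (Fin n)) : ℕ :=
  if h : ∃ l : List (Fin n × Fin n),
      (∀ p ∈ l, p.1 < p.2) ∧ l.Chain' (fun p q => p.2 < q.2) ∧
      σ = (l.map fun p => Equiv.swap p.1 p.2).prod
  then (h.choose.map fun p => (p.2 : ℕ) - (p.1 : ℕ)).sum
  else 0

/-- `DIS σ = sor σ⁻¹`. -/
noncomputable def DIS {n : ℕ} (σ : Equiv.Perm (Fin n)) : ℕ := sorStat σ⁻¹

/-- 213-avoiding permutations: no `i < j < l` with `π j < π i < π l`. -/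
def avoids213 {n : ℕ} (π : Equiv.Perm (Fin n)) : Prop :=
  ¬ ∃ i j l : Fin n, i < j ∧ j < l ∧ π j < π i ∧ π i < π l

/-- 132-avoiding permutations: no `i < j < l` with `π i < π l < π j`. -/
def avoids132 {n : ℕ} (π : Equiv.Perm (Fin n)) : Prop :=
  ¬ ∃ i j l : Fin n, i < j ∧ j < l ∧ π i < π l ∧ π l < π j

/-- 321-avoiding permutations: no `i < j < l` with `π i > π j > π l`. -/
def avoids321 {n : ℕ} (π : Equiv.Perm (Fin n)) : Prop :=
  ¬ ∃ i j l : Fin n, i < j ∧ j < l ∧ π l < π j ∧ π j < π i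

/-- The number of descents of a permutation. -/
def desStat {n : ℕ} (π : Equiv.Perm (Fin n)) : ℕ :=
  (Finset.univ.filter fun i : Fin n =>
    ∃ j : Fin n, (j : ℕ) = (i : ℕ) + 1 ∧ π j < π i).card

/-- The number of right-to-left maxima of a permutation. -/
def rmaxStat {n : ℕ} (π : Equiv.Perm (Fin n)) : ℕ :=
  (Finset.univ.filter fun i : Fin n => ∀ j, i < j → π j < π i).card

/-- The number of non-weak excedances before the last position. -/
def vnwStat {N : ℕ} (π : Equiv.Perm (Fin N)) : ℕ :=
  (Finset.univ.filter fun i : Fin N => (i : ℕ) + 1 < N ∧ (π i : ℕ) < (i : ℕ)).card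

/-- `Γ_{n,k}`: sequences of `n` ones (`true`) and `k` negative ones (`false`)
with all partial sums nonnegative. -/
noncomputable def GammaBP (n k : ℕ) : Finset (Fin (n + k) → Bool) :=
  Finset.univ.filter fun a =>
    (Finset.univ.filter fun i => a i = true).card = n ∧
    ∀ m ∈ Finset.range (n + k + 1),
      (Finset.univ.filter fun i : Fin (n + k) => (i : ℕ) < m ∧ a i = false).card ≤
      (Finset.univ.filter fun i : Fin (n + k) => (i : ℕ) < m ∧ a i = true).card

/-- `vpk a`: the number of ones immediately followed by a `-1` that are not the
rightmost one. -/
def vpkStat {N : ℕ} (a : Fin N → Bool) : ℕ :=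
  (Finset.univ.filter fun i : Fin N =>
    a i = true ∧ (∃ j : Fin N, (j : ℕ) = (i : ℕ) + 1 ∧ a j = false) ∧
    ∃ j : Fin N, i < j ∧ a j = true).card

/-- `Γ^u_{n,k}`: elements of `Γ_{n,k}` ending with a one. -/
noncomputable def GammaBPU (n k : ℕ) : Finset (Fin (n + k) → Bool) :=
  (GammaBP n k).filter fun a => ∀ i : Fin (n + k), (i : ℕ) + 1 = n + k → a i = true

/-- `Γ^d_{n,k}`: elements of `Γ_{n,k}` ending with a negative one. -/
noncomputable def GammaBPD (n k : ℕ) : Finset (Fin (n + k) → Bool) :=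
  (GammaBP n k).filter fun a => ∀ i : Fin (n + k), (i : ℕ) + 1 = n + k → a i = false

/-- The transposition `t_{i,j}` of `1`-based positions `i` and `j`. -/
def transp (n i j : ℕ) : Equiv.Perm (Fin n) :=
  if h : i - 1 < n ∧ j - 1 < n then Equiv.swap ⟨i - 1, h.1⟩ ⟨j - 1, h.2⟩ else 1

/-- `Ψ_{i,k} = 1 + sᵢ + sᵢsᵢ₋₁ + ⋯` (with `min i k + 1` terms) in `ℤ[Sₙ]`,
where `sᵢ = (i, i+1)` (1-based). -/
noncomputable def PsiElt (n k i : ℕ) : MonoidAlgebra ℤ (Equiv.Perm (Fin n)) :=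
  ∑ m ∈ Finset.range (min i k + 1),
    MonoidAlgebra.of ℤ (Equiv.Perm (Fin n))
      (((List.range m).map fun r => transp n (i - r) (i - r + 1)).prod)

/-- `Φ_{i,k} = 1 + t_{i,i+1} + t_{i-1,i+1} + ⋯` (with `min i k + 1` terms)
in `ℤ[Sₙ]`. -/
noncomputable def PhiElt (n k i : ℕ) : MonoidAlgebra ℤ (Equiv.Perm (Fin n)) :=
  ∑ m ∈ Finset.range (min i k + 1),
    MonoidAlgebra.of ℤ (Equiv.Perm (Fin n)) (transp n (i + 1 - m) (i + 1))

/-- `[i]_q = 1 + q + ⋯ + q^{i-1}` as an element of `ℤ[q,t]`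
(with `q = X 0`, `t = X 1`). -/
noncomputable def qBracket (i : ℕ) : MvPolynomial (Fin 2) ℤ :=
  ∑ j ∈ Finset.range i, MvPolynomial.X 0 ^ j

/-- Number of larger entries to the left of position `i`. -/
noncomputable def lcode {n : ℕ} (σ : Equiv.Perm (Fin n)) (i : Fin n) : ℕ :=
  (Finset.univ.filter fun j : Fin n => j < i ∧ σ i < σ j).card

lemma invStat_eq {n : ℕ} (σ : Equiv.Perm (Fin n)) : invStat σ = ∑ i, lcode σ i := by
  unfold invStat lcode
  rw [Finset.card_eq_sum_card_fiberwise (f := fun p : Fin n × Fin n => p.2) (t := Finset.univ)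
    (by intro x _; simp)]
  refine Finset.sum_congr rfl fun i _ => ?_
  refine Finset.card_bij (fun p _ => p.1) ?_ ?_ ?_
  · rintro ⟨a, b⟩ h
    simp at h ⊢
    obtain ⟨h, rfl⟩ := h
    exact h
  · rintro ⟨a, b⟩ h ⟨c, d⟩ h' e
    simp at h h' e ⊢
    exact ⟨e, h.2.trans h'.2.symm⟩
  · intro j hj
    exact ⟨(j, i), by simpa using hj, rfl⟩

lemma lcode_eq_zero {n : ℕ} (σ : Equiv.Perm (Fin n)) (i : Fin n) :
    lcode σ i = 0 ↔ ∀ j, j < i → σ j < σ i := by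
  unfold lcode
  rw [Finset.card_eq_zero, Finset.filter_eq_empty_iff]
  constructor
  · intro h j hj
    have := h (Finset.mem_univ j)
    rcases lt_trichotomy (σ j) (σ i) with h1 | h1 | h1
    · exact h1
    · exact absurd (σ.injective h1) hj.ne
    · exact absurd ⟨hj, h1⟩ this
  · rintro h j - ⟨h1, h2⟩
    exact absurd (h j h1) h2.asymm

lemma card_le_val {n : ℕ} (σ : Equiv.Perm (Fin n)) (a : Fin n) :
    (Finset.univ.filter fun j : Fin n => σ j ≤ a).card = a + 1 := by
  rw [← Fin.card_Iic a]
  refine Finset.card_bij (fun j _ => σ j) ?_ ?_ ?_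
  · intro j hj; simpa using hj
  · intro j _ k _ h; exact σ.injective h
  · intro b hb; exact ⟨σ.symm b, by simpa using hb, by simp⟩

lemma maxdrop_le_iff {n : ℕ} (σ : Equiv.Perm (Fin n)) (k : ℕ) :
    maxdrop σ ≤ k ↔ ∀ i, lcode σ i ≤ k := by
  unfold maxdrop
  rw [Finset.sup_le_iff]
  constructor
  · intro h i
    set S := Finset.univ.filter fun j : Fin n => σ j ≤ σ i with hS
    have hne : S.Nonempty := ⟨i, by simp [hS]⟩
    set m := S.max' hne with hm
    have hmS : m ∈ S := S.max'_mem hne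
    have him : i ≤ m := S.le_max' i (by simp [hS])
    have hsm : σ m ≤ σ i := by simpa [hS] using hmS
    have hdisj : Disjoint S (Finset.univ.filter fun j : Fin n => j < i ∧ σ i < σ j) := by
      rw [Finset.disjoint_left]
      intro a ha hb
      simp [hS] at ha hb
      exact absurd ha (not_le.2 hb.2)
    have hsub : (S.disjUnion _ hdisj) ⊆ Finset.Iic m := by
      intro a ha
      rw [Finset.mem_disjUnion] at ha
      rw [Finset.mem_Iic]
      rcases ha with ha | ha
      · exact S.le_max' a ha
      · simp at ha
        exact ha.1.le.trans him
    have hc := Finset.card_le_card hsub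
    rw [Finset.card_disjUnion, Fin.card_Iic, hS, card_le_val] at hc
    have := h m (Finset.mem_univ m)
    have h3 : (σ m : ℕ) ≤ σ i := hsm
    unfold lcode
    omega
  · intro h i _
    have h1 := h i
    have hsub : Finset.Iic i ⊆ (Finset.univ.filter fun j : Fin n => σ j ≤ σ i) ∪
        (Finset.univ.filter fun j : Fin n => j < i ∧ σ i < σ j) := by
      intro a ha
      simp at ha ⊢
      by_cases hc : σ a ≤ σ i
      · exact Or.inl hc
      · right
        refine ⟨lt_of_le_of_ne ha ?_, not_le.1 hc⟩
        rintro rfl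
        exact hc le_rfl
    have hc := (Finset.card_le_card hsub).trans (Finset.card_union_le _ _)
    rw [Fin.card_Iic, card_le_val] at hc
    unfold lcode at h1
    omega

/-- Append a last entry `v`. -/
def snocPerm {n : ℕ} (v : Fin (n + 1)) (τ : Equiv.Perm (Fin n)) : Equiv.Perm (Fin (n + 1)) :=
  ((finSuccEquiv' (Fin.last n)).trans (Equiv.optionCongr τ)).trans (finSuccEquiv' v).symm

@[simp] lemma snocPerm_last {n : ℕ} (v : Fin (n + 1)) (τ : Equiv.Perm (Fin n)) :
    snocPerm v τ (Fin.last n) = v := by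
  simp [snocPerm]

@[simp] lemma snocPerm_castSucc {n : ℕ} (v : Fin (n + 1)) (τ : Equiv.Perm (Fin n)) (i : Fin n) :
    snocPerm v τ i.castSucc = v.succAbove (τ i) := by
  have := finSuccEquiv'_succAbove (Fin.last n) i
  rw [Fin.succAbove_last] at this
  simp [snocPerm, this]

lemma snocPerm_bij (n : ℕ) :
    Function.Bijective (fun p : Fin (n + 1) × Equiv.Perm (Fin n) => snocPerm p.1 p.2) := by
  rw [Fintype.bijective_iff_injective_and_card]
  constructor
  · rintro ⟨v, τ⟩ ⟨v', τ'⟩ h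
    simp only at h
    have h1 : v = v' := by
      have := congrArg (fun e : Equiv.Perm (Fin (n + 1)) => e (Fin.last n)) h
      simpa using this
    subst h1
    have h2 : τ = τ' := by
      ext1 i
      have := congrArg (fun e : Equiv.Perm (Fin (n + 1)) => e i.castSucc) h
      simpa using this
    rw [h2]
  · rw [Fintype.card_prod, Fintype.card_perm, Fintype.card_perm, Fintype.card_fin,
      Fintype.card_fin, Nat.factorial_succ]

lemma lcode_snoc_castSucc {n : ℕ} (v : Fin (n + 1)) (τ : Equiv.Perm (Fin n)) (i : Fin n) :
    lcode (snocPerm v τ) i.castSucc = lcode τ i := by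
  unfold lcode
  symm
  refine Finset.card_bij (fun j _ => j.castSucc) ?_ ?_ ?_
  · intro j hj
    simpa using hj
  · intro j _ k _ h; simpa using h
  · intro b hb
    simp only [Finset.mem_filter, Finset.mem_univ, true_and] at hb
    induction b using Fin.lastCases with
    | last => exact absurd hb.1 (not_lt.2 (Fin.le_last _))
    | cast j => exact ⟨j, by simpa using hb, rfl⟩

lemma lcode_snoc_last {n : ℕ} (v : Fin (n + 1)) (τ : Equiv.Perm (Fin n)) :
    lcode (snocPerm v τ) (Fin.last n) = n - v := by
  have : (Finset.Ioi v).card = n - v := by rw [Fin.card_Ioi]; omega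
  rw [← this]
  unfold lcode
  refine Finset.card_bij (fun j _ => snocPerm v τ j) ?_ ?_ ?_
  · intro j hj
    simp at hj ⊢
    exact hj.2
  · intro j _ k _ h; exact (snocPerm v τ).injective h
  · intro b hb
    have hb' : v < b := by simpa using hb
    refine ⟨(snocPerm v τ).symm b, ?_, by simp⟩
    simp only [Finset.mem_filter, Finset.mem_univ, true_and, snocPerm_last,
      Equiv.apply_symm_apply]
    refine ⟨lt_of_le_of_ne (Fin.le_last _) ?_, hb'⟩
    intro h
    rw [Equiv.symm_apply_eq, snocPerm_last] at h
    exact absurd h hb'.ne'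

lemma sum_prod_lcode {R : Type*} [CommRing R] (f : ℕ → R) (n : ℕ) :
    ∑ σ : Equiv.Perm (Fin n), ∏ i, f (lcode σ i) =
      ∏ i ∈ Finset.range n, ∑ c ∈ Finset.range (i + 1), f c := by
  induction n with
  | zero => simp
  | succ n ih =>
    rw [Finset.prod_range_succ, ← ih,
      ← (Function.Bijective.sum_comp (snocPerm_bij n) _), Fintype.sum_prod_type_right,
      Finset.sum_mul]
    refine Finset.sum_congr rfl fun τ _ => ?_
    simp only [Fin.prod_univ_castSucc, lcode_snoc_castSucc, lcode_snoc_last]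
    rw [← Finset.mul_sum, ← Finset.sum_range_reflect, Finset.sum_range]
    simp

/-- the joint generating function of `(inv, lmax)` over `A(n,k)`,
in `ℤ[q,t]` with `q = X 0`, `t = X 1`. -/
theorem stmt1 (n k : ℕ) (hn : 1 ≤ n) (hk0 : 0 < k) (hk : k ≤ n) :
    ∑ σ ∈ bddA n k,
        (MvPolynomial.X 0 : MvPolynomial (Fin 2) ℤ) ^ invStat σ *
          MvPolynomial.X 1 ^ lmaxStat σ =
      (MvPolynomial.X 1 + qBracket (k + 1) - 1) ^ (n - k) *
        ∏ i ∈ Finset.Icc 1 k, (MvPolynomial.X 1 + qBracket i - 1) := by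
  set f : ℕ → MvPolynomial (Fin 2) ℤ := fun c =>
    if c ≤ k then MvPolynomial.X 0 ^ c * (if c = 0 then MvPolynomial.X 1 else 1) else 0 with hf
  have key : ∀ σ : Equiv.Perm (Fin n), (if maxdrop σ ≤ k then
      (MvPolynomial.X 0 : MvPolynomial (Fin 2) ℤ) ^ invStat σ *
          MvPolynomial.X 1 ^ lmaxStat σ else 0) = ∏ i, f (lcode σ i) := by
    intro σ
    split_ifs with h
    · rw [maxdrop_le_iff] at h
      simp only [hf, h, if_true]
      rw [Finset.prod_mul_distrib, Finset.prod_pow_eq_pow_sum, ← invStat_eq, Finset.prod_ite]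
      simp only [Finset.prod_const, one_pow, mul_one, lcode_eq_zero]
      rfl
    · rw [maxdrop_le_iff] at h
      push Not at h
      obtain ⟨i, hi⟩ := h
      exact (Finset.prod_eq_zero (Finset.mem_univ i) (by simp [hf, not_le.2 hi])).symm
  have hsmall : ∀ i, i ≤ k → ∑ c ∈ Finset.range (i + 1), f c =
      MvPolynomial.X 1 + qBracket (i + 1) - 1 := by
    intro i hi
    induction i with
    | zero => simp [hf, qBracket]
    | succ i ih =>
      rw [Finset.sum_range_succ, ih (by omega)]
      simp only [qBracket, Finset.sum_range_succ _ (i + 1)]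
      simp [hf, hi]
      ring
  have hbig : ∀ d, ∑ c ∈ Finset.range (k + d + 1), f c =
      MvPolynomial.X 1 + qBracket (k + 1) - 1 := by
    intro d
    induction d with
    | zero => exact hsmall k le_rfl
    | succ d ih =>
      rw [← add_assoc, Finset.sum_range_succ, ih]
      simp [hf, add_assoc]
  unfold bddA
  rw [Finset.sum_filter, Finset.sum_congr rfl (fun σ _ => key σ), sum_prod_lcode]
  obtain ⟨d, rfl⟩ := Nat.exists_eq_add_of_le hk
  rw [Finset.prod_range_add, Finset.prod_congr rfl (fun i _ => hbig i), mul_comm]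
  congr 1
  · simp
  · rw [Finset.prod_congr rfl (fun i hi => hsmall i (Finset.mem_range.1 hi).le)]
    rw [Finset.range_eq_Ico, Finset.prod_Ico_add' (fun i => MvPolynomial.X 1 + qBracket i - 1) 0 k 1]
    rfl
end

section
/- For all integers n ≥ 1 and 0 < k ≤ n, the following polynomial identity in ℤ[q,t] holds: Σ_{σ ∈ A(n,k)} q^{DIS(σ)} t^{cyc(σ)} = (t + [k+1]_q − 1)^{n−k} · Π_{i=1}^{k} (t + [i]_q − 1). -/
attribute [local instance] Classical.propDecidable

section Helpers

open Equiv Equiv.Perm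

theorem cycleType_swap_mul_aux {α : Type*} [Fintype α] [DecidableEq α] (f : Perm α) (a p : α)
    (hap : a ≠ p) (ha : f a = a) :
    (swap a p * f).cycleType.card + f.cycleType.sum + 1 =
      f.cycleType.card + (swap a p * f).cycleType.sum := by
  by_cases hp : f p = p
  · have hd : Perm.Disjoint (swap a p) f := by
      intro x
      by_cases hxa : x = a
      · right; rw [hxa, ha]
      by_cases hxp : x = p
      · right; rw [hxp, hp]
      left; exact swap_apply_of_ne_of_ne hxa hxp
    rw [hd.cycleType_mul, (isCycle_swap hap).cycleType, card_support_swap hap]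
    simp only [Multiset.card_add, Multiset.sum_add, Multiset.card_singleton,
      Multiset.sum_singleton]
    omega
  · have hps : p ∈ f.support := mem_support.mpr hp
    obtain ⟨l, hl⟩ : ∃ l, toList f p = p :: l := by
      have h0 := toList_getElem_zero f p hps
      cases h : toList f p with
      | nil => rw [toList_eq_nil_iff] at h; exact absurd hps h
      | cons b l =>
        simp only [h, List.getElem_cons_zero] at h0
        exact ⟨l, by rw [h0]⟩
    have hnd : (p :: l).Nodup := hl ▸ nodup_toList f p
    have hlen : 2 ≤ (p :: l).length := by
      cases l with
      | nil => exact absurd hl (toList_ne_singleton f p p)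
      | cons b l => simp
    have hc : List.formPerm (p :: l) = f.cycleOf p := by rw [← hl, formPerm_toList]
    have hanot : a ∉ p :: l := by
      rw [← hl, mem_toList_iff]
      rintro ⟨h1, -⟩
      exact hp (h1.apply_eq_self_iff.mpr ha)
    set c := List.formPerm (p :: l) with hcdef
    have hd : Perm.Disjoint (f * c⁻¹) c := by
      rw [hc]
      exact disjoint_mul_inv_of_mem_cycleFactorsFinset
        (cycleOf_mem_cycleFactorsFinset_iff.mpr hps)
    have hca : c a = a := List.formPerm_apply_of_notMem hanot
    have hca' : c⁻¹ a = a := by rw [Perm.inv_eq_iff_eq, hca]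
    set g := f * c⁻¹ with hg
    have hga : g a = a := by rw [hg, Perm.mul_apply, hca', ha]
    have hf : f = c * g := by rw [← hd.commute.eq, hg, inv_mul_cancel_right]
    have hC : swap a p * c = List.formPerm (a :: p :: l) := by
      rw [List.formPerm_cons_cons]
    have hnd' : (a :: p :: l).Nodup := List.nodup_cons.mpr ⟨hanot, hnd⟩
    have hd' : Perm.Disjoint (List.formPerm (a :: p :: l)) g := by
      intro x
      rcases hd x with h | h
      · right; exact h
      · by_cases hxa : x = a
        · right; rw [hxa, hga]
        · left
          apply List.formPerm_apply_of_notMem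
          intro hx
          rcases List.mem_cons.mp hx with hx | hx
          · exact hxa hx
          · exact (List.formPerm_apply_mem_ne_self_iff _ hnd _ hx).mpr hlen h
    have hlen' : 2 ≤ (a :: p :: l).length := by simp
    have hs1 : c.support.card = (p :: l).length := by
      rw [hcdef, List.support_formPerm_of_nodup _ hnd, List.toFinset_card_of_nodup hnd]
      intro x hx; rw [hx] at hlen; simp at hlen
    have hs2 : (List.formPerm (a :: p :: l)).support.card = (a :: p :: l).length := by
      rw [List.support_formPerm_of_nodup _ hnd', List.toFinset_card_of_nodup hnd']
      intro x hx; simp at hx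
    have e1 : f.cycleType = {(p :: l).length} + g.cycleType := by
      conv_lhs => rw [hf]
      rw [hd.symm.cycleType_mul, (List.isCycle_formPerm hnd hlen).cycleType, hs1]
    have e2 : (swap a p * f).cycleType = {(a :: p :: l).length} + g.cycleType := by
      conv_lhs => rw [hf, ← mul_assoc, hC]
      rw [hd'.cycleType_mul, (List.isCycle_formPerm hnd' hlen').cycleType, hs2]
    rw [e1, e2]
    simp only [Multiset.card_add, Multiset.sum_add, Multiset.card_singleton,
      Multiset.sum_singleton, List.length_cons]
    omega

theorem cycStat_add_sum {n : ℕ} (π : Perm (Fin n)) :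
    cycStat π + π.cycleType.sum = π.cycleType.card + n := by
  unfold cycStat
  rw [sum_cycleType]
  have : (Finset.univ.filter fun i => π i = i) = π.supportᶜ := by
    ext i; simp
  rw [this, Finset.card_compl, Fintype.card_fin]
  have := Finset.card_le_univ π.support
  rw [Fintype.card_fin] at this
  omega

/-- extension of a permutation by a fixed last point -/
noncomputable def liftP {n : ℕ} (e : Perm (Fin n)) : Perm (Fin (n + 1)) :=
  e.viaFintypeEmbedding Fin.castSuccEmb

theorem liftP_castSucc {n : ℕ} (e : Perm (Fin n)) (i : Fin n) :
    liftP e i.castSucc = (e i).castSucc :=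
  e.viaFintypeEmbedding_apply_image Fin.castSuccEmb i

theorem liftP_last {n : ℕ} (e : Perm (Fin n)) : liftP e (Fin.last n) = Fin.last n := by
  apply Equiv.Perm.viaFintypeEmbedding_apply_notMem_range
  rintro ⟨x, hx⟩
  exact (Fin.castSucc_lt_last x).ne hx

theorem liftP_mul {n : ℕ} (e f : Perm (Fin n)) : liftP (e * f) = liftP e * liftP f := by
  ext x
  induction x using Fin.lastCases with
  | last => simp [liftP_last]
  | cast i => simp [liftP_castSucc]

theorem liftP_one {n : ℕ} : liftP (1 : Perm (Fin n)) = 1 := by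
  ext x
  induction x using Fin.lastCases with
  | last => simp [liftP_last]
  | cast i => simp [liftP_castSucc]

theorem liftP_inv {n : ℕ} (e : Perm (Fin n)) : liftP e⁻¹ = (liftP e)⁻¹ := by
  rw [eq_inv_iff_mul_eq_one, ← liftP_mul, inv_mul_cancel, liftP_one]

theorem liftP_swap {n : ℕ} (a b : Fin n) :
    liftP (swap a b) = swap a.castSucc b.castSucc := by
  ext x
  induction x using Fin.lastCases with
  | last =>
    rw [liftP_last, swap_apply_of_ne_of_ne (Fin.castSucc_lt_last a).ne'
      (Fin.castSucc_lt_last b).ne']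
  | cast i =>
    rw [liftP_castSucc]
    by_cases h1 : i = a
    · subst h1; simp
    by_cases h2 : i = b
    · subst h2; simp
    rw [swap_apply_of_ne_of_ne h1 h2, swap_apply_of_ne_of_ne]
    · exact fun h => h1 (Fin.castSucc_injective _ h)
    · exact fun h => h2 (Fin.castSucc_injective _ h)

theorem liftP_injective {n : ℕ} : Function.Injective (liftP (n := n)) := by
  intro e f h
  ext i
  have := congrArg (fun g => g i.castSucc) h
  simp only [liftP_castSucc] at this
  rw [Fin.castSucc_injective _ this]

theorem cycleType_liftP {n : ℕ} (e : Perm (Fin n)) : (liftP e).cycleType = e.cycleType := by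
  unfold liftP Equiv.Perm.viaFintypeEmbedding
  exact cycleType_extendDomain _

/-- insertion map -/
noncomputable def insP {n : ℕ} (x : Fin (n + 1) × Perm (Fin n)) : Perm (Fin (n + 1)) :=
  swap (Fin.last n) x.1 * liftP x.2

theorem insP_last {n : ℕ} (x : Fin (n + 1) × Perm (Fin n)) : insP x (Fin.last n) = x.1 := by
  simp [insP, liftP_last]

theorem insP_bijective {n : ℕ} : Function.Bijective (insP (n := n)) := by
  rw [Fintype.bijective_iff_injective_and_card]
  constructor
  · rintro ⟨p, e⟩ ⟨p', e'⟩ h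
    have h1 : p = p' := by
      have := congrArg (fun g => g (Fin.last n)) h
      simpa only [insP_last] using this
    subst h1
    have := liftP_injective (mul_left_cancel (show swap (Fin.last n) p * liftP e = _ from h))
    rw [this]
  · rw [Fintype.card_prod, Fintype.card_perm, Fintype.card_perm, Fintype.card_fin,
      Fintype.card_fin, Nat.factorial_succ]

theorem cycStat_insP_last {n : ℕ} (e : Perm (Fin n)) :
    cycStat (insP (Fin.last n, e)) = cycStat e + 1 := by
  have h1 := cycStat_add_sum (insP (Fin.last n, e))
  have h2 := cycStat_add_sum e
  have h3 : insP (Fin.last n, e) = liftP e := by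
    show swap _ _ * _ = _
    rw [swap_self]; rfl
  rw [h3, cycleType_liftP] at h1
  rw [h3]
  omega

theorem cycStat_insP_castSucc {n : ℕ} (e : Perm (Fin n)) (i : Fin n) :
    cycStat (insP (i.castSucc, e)) = cycStat e := by
  have h1 := cycStat_add_sum (insP (i.castSucc, e))
  have h2 := cycStat_add_sum e
  have h3 := cycleType_swap_mul_aux (liftP e) (Fin.last n) i.castSucc
    (Fin.castSucc_lt_last i).ne' (liftP_last e)
  rw [cycleType_liftP] at h3
  unfold insP at *
  simp only at *
  omega

/-- valid factorization lists -/
def GoodL {n : ℕ} (l : List (Fin n × Fin n)) : Prop :=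
  (∀ p ∈ l, p.1 < p.2) ∧ l.Chain' (fun p q => p.2 < q.2)

/-- product of the list -/
noncomputable def prodL {n : ℕ} (l : List (Fin n × Fin n)) : Perm (Fin n) :=
  (l.map fun p => Equiv.swap p.1 p.2).prod

/-- weight of the list -/
def sumL {n : ℕ} (l : List (Fin n × Fin n)) : ℕ :=
  (l.map fun p => (p.2 : ℕ) - (p.1 : ℕ)).sum

theorem GoodL_append {n : ℕ} (l : List (Fin n × Fin n)) (p : Fin n × Fin n) :
    GoodL (l ++ [p]) ↔ GoodL l ∧ p.1 < p.2 ∧ ∀ q ∈ l, q.2 < p.2 := by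
  unfold GoodL List.Chain'
  have : IsTrans (Fin n × Fin n) (fun p q => p.2 < q.2) := ⟨fun _ _ _ h1 h2 => lt_trans h1 h2⟩
  rw [List.isChain_iff_pairwise, List.isChain_iff_pairwise, List.pairwise_append]
  simp only [List.mem_append, List.mem_singleton, List.pairwise_singleton, forall_eq, true_and]
  constructor
  · rintro ⟨h1, h2, h3⟩
    exact ⟨⟨fun q hq => h1 q (Or.inl hq), h2⟩, h1 p (Or.inr rfl), h3⟩
  · rintro ⟨⟨h1, h2⟩, h3, h4⟩
    refine ⟨?_, h2, h4⟩
    rintro q (hq | rfl)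
    · exact h1 q hq
    · exact h3

theorem prodL_append {n : ℕ} (l : List (Fin n × Fin n)) (p : Fin n × Fin n) :
    prodL (l ++ [p]) = prodL l * swap p.1 p.2 := by
  simp [prodL]

theorem sumL_append {n : ℕ} (l : List (Fin n × Fin n)) (p : Fin n × Fin n) :
    sumL (l ++ [p]) = sumL l + ((p.2 : ℕ) - (p.1 : ℕ)) := by
  simp [sumL]

theorem prodL_fix {n : ℕ} (l : List (Fin n × Fin n)) (hl : ∀ p ∈ l, p.1 < p.2) (x : Fin n)
    (hx : ∀ q ∈ l, q.2 < x) : prodL l x = x := by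
  induction l with
  | nil => simp [prodL]
  | cons p l ih =>
    have h1 : prodL (p :: l) = swap p.1 p.2 * prodL l := by simp [prodL]
    have h2 := ih (fun q hq => hl q (List.mem_cons_of_mem _ hq))
      (fun q hq => hx q (List.mem_cons_of_mem _ hq))
    have h3 := hl p List.mem_cons_self
    have h4 := hx p List.mem_cons_self
    rw [h1, Perm.mul_apply, h2, swap_apply_of_ne_of_ne (h3.trans h4).ne' h4.ne']

theorem prodL_append_fix {n : ℕ} (l : List (Fin n × Fin n)) (p : Fin n × Fin n)
    (h : GoodL (l ++ [p])) :
    prodL (l ++ [p]) p.1 = p.2 ∧ ∀ x, p.2 < x → prodL (l ++ [p]) x = x := by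
  constructor
  · have h' := (GoodL_append l p).mp h
    rw [prodL_append, Perm.mul_apply, swap_apply_left]
    exact prodL_fix l h'.1.1 _ h'.2.2
  · intro x hx
    have h' := (GoodL_append l p).mp h
    apply prodL_fix _ h.1
    intro q hq
    rcases List.mem_append.mp hq with hq | hq
    · exact (h'.2.2 q hq).trans hx
    · rw [List.mem_singleton.mp hq]; exact hx

theorem GoodL_unique {n : ℕ} (l l' : List (Fin n × Fin n)) (h : GoodL l) (h' : GoodL l')
    (he : prodL l = prodL l') : l = l' := by
  induction l using List.reverseRecOn generalizing l' with
  | nil =>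
    rcases List.eq_nil_or_concat l' with rfl | ⟨m, p, rfl⟩
    · rfl
    · exfalso
      rw [List.concat_eq_append] at *
      have h1 := (prodL_append_fix m p h').1
      have h2 := ((GoodL_append m p).mp h').2.1
      rw [← he] at h1
      exact h2.ne (by simpa [prodL] using h1)
  | append_singleton l p ih =>
    rcases List.eq_nil_or_concat l' with rfl | ⟨m, r, rfl⟩
    · exfalso
      have h1 := (prodL_append_fix l p h).1
      have h2 := ((GoodL_append l p).mp h).2.1
      rw [he] at h1
      exact h2.ne (by simpa [prodL] using h1)
    · rw [List.concat_eq_append] at *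
      obtain ⟨a1, a2⟩ := prodL_append_fix l p h
      obtain ⟨b1, b2⟩ := prodL_append_fix m r h'
      obtain ⟨a3, a4, -⟩ := (GoodL_append l p).mp h
      obtain ⟨b3, b4, -⟩ := (GoodL_append m r).mp h'
      have key : p.2 = r.2 := by
        rcases lt_trichotomy p.2 r.2 with hlt | heq | hlt
        · exfalso
          have := a2 _ hlt
          rw [he, ← b1] at this
          exact b4.ne (b1 ▸ ((prodL (m ++ [r])).injective this).symm)
        · exact heq
        · exfalso
          have := b2 _ hlt
          rw [← he, ← a1] at this
          exact a4.ne (a1 ▸ ((prodL (l ++ [p])).injective this).symm)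
      have key1 : p.1 = r.1 := by
        apply (prodL (l ++ [p])).injective
        rw [a1, he, b1, key]
      have hpr : p = r := Prod.ext key1 key
      subst hpr
      rw [prodL_append, prodL_append] at he
      rw [ih m a3 b3 (mul_right_cancel he)]

theorem sorStat_eq {n : ℕ} (l : List (Fin n × Fin n)) (h : GoodL l) :
    sorStat (prodL l) = sumL l := by
  have hex : ∃ l' : List (Fin n × Fin n),
      (∀ p ∈ l', p.1 < p.2) ∧ l'.Chain' (fun p q => p.2 < q.2) ∧
      prodL l = (l'.map fun p => Equiv.swap p.1 p.2).prod := ⟨l, h.1, h.2, rfl⟩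
  unfold sorStat
  rw [dif_pos hex]
  have hs := hex.choose_spec
  have : hex.choose = l := (GoodL_unique l _ h ⟨hs.1, hs.2.1⟩ hs.2.2).symm
  rw [this]
  rfl

/-- lift of lists -/
def liftL {n : ℕ} (l : List (Fin n × Fin n)) : List (Fin (n + 1) × Fin (n + 1)) :=
  l.map fun p => (p.1.castSucc, p.2.castSucc)

theorem GoodL_liftL {n : ℕ} (l : List (Fin n × Fin n)) (h : GoodL l) : GoodL (liftL l) := by
  constructor
  · intro p hp
    obtain ⟨q, hq, rfl⟩ := List.mem_map.mp hp
    exact h.1 q hq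
  · have := h.2
    unfold liftL List.Chain' at *
    rw [List.isChain_map]
    exact this

theorem prodL_liftL {n : ℕ} (l : List (Fin n × Fin n)) : prodL (liftL l) = liftP (prodL l) := by
  induction l with
  | nil => exact liftP_one.symm
  | cons p l ih =>
    have h1 : prodL (p :: l) = swap p.1 p.2 * prodL l := by simp [prodL]
    have h2 : prodL (liftL (p :: l)) = swap p.1.castSucc p.2.castSucc * prodL (liftL l) := by
      simp [prodL, liftL]
    rw [h1, h2, liftP_mul, liftP_swap, ih]

theorem sumL_liftL {n : ℕ} (l : List (Fin n × Fin n)) : sumL (liftL l) = sumL l := by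
  simp [sumL, liftL, Function.comp_def]

theorem insP_castSucc_inv {n : ℕ} (i : Fin n) (e : Perm (Fin n)) :
    (insP (i.castSucc, e))⁻¹ = liftP e⁻¹ * swap i.castSucc (Fin.last n) := by
  unfold insP
  rw [mul_inv_rev, swap_inv, swap_comm, liftP_inv]

theorem insP_last_eq {n : ℕ} (e : Perm (Fin n)) : insP (Fin.last n, e) = liftP e := by
  show swap _ _ * _ = _
  rw [swap_self]; rfl

theorem GoodL_ext {n : ℕ} (l : List (Fin n × Fin n)) (h : GoodL l) (i : Fin n) :
    GoodL (liftL l ++ [(i.castSucc, Fin.last n)]) := by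
  rw [GoodL_append]
  refine ⟨GoodL_liftL l h, Fin.castSucc_lt_last i, ?_⟩
  intro q hq
  obtain ⟨r, hr, rfl⟩ := List.mem_map.mp hq
  exact Fin.castSucc_lt_last _

theorem GoodL_exists {n : ℕ} (σ : Perm (Fin n)) : ∃ l, GoodL l ∧ prodL l = σ⁻¹ := by
  induction n with
  | zero => exact ⟨[], ⟨by simp, List.isChain_nil⟩, Subsingleton.elim _ _⟩
  | succ n ih =>
    obtain ⟨⟨p, e⟩, rfl⟩ := insP_bijective.2 σ
    obtain ⟨l, hl, hle⟩ := ih e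
    induction p using Fin.lastCases with
    | last =>
      refine ⟨liftL l, GoodL_liftL l hl, ?_⟩
      rw [prodL_liftL, hle, insP_last_eq, liftP_inv]
    | cast i =>
      refine ⟨_, GoodL_ext l hl i, ?_⟩
      rw [prodL_append, prodL_liftL, hle, insP_castSucc_inv]

theorem DIS_insP_last {n : ℕ} (e : Perm (Fin n)) : DIS (insP (Fin.last n, e)) = DIS e := by
  obtain ⟨l, hl, hle⟩ := GoodL_exists e
  unfold DIS
  rw [insP_last_eq, ← liftP_inv, ← hle, ← prodL_liftL, sorStat_eq _ hl,
    sorStat_eq _ (GoodL_liftL l hl), sumL_liftL]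

theorem DIS_insP_castSucc {n : ℕ} (i : Fin n) (e : Perm (Fin n)) :
    DIS (insP (i.castSucc, e)) = DIS e + (n - i) := by
  obtain ⟨l, hl, hle⟩ := GoodL_exists e
  unfold DIS
  have h := sorStat_eq _ (GoodL_ext l hl i)
  rw [prodL_append, prodL_liftL, sumL_append, sumL_liftL] at h
  rw [insP_castSucc_inv, ← hle, sorStat_eq _ hl]
  exact h

theorem mem_bddA {n k : ℕ} (σ : Perm (Fin n)) :
    σ ∈ bddA n k ↔ ∀ i : Fin n, (i : ℕ) ≤ σ i + k := by
  unfold bddA maxdrop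
  simp only [Finset.mem_filter, Finset.mem_univ, true_and, Finset.sup_le_iff, forall_const]
  exact forall_congr' fun i => by omega

theorem insP_mem {n k : ℕ} (p : Fin (n + 1)) (e : Perm (Fin n)) :
    insP (p, e) ∈ bddA (n + 1) k ↔ n ≤ p + k ∧ e ∈ bddA n k := by
  rw [mem_bddA, mem_bddA]
  have hval : ∀ i : Fin n, insP (p, e) i.castSucc =
      if (e i).castSucc = p then Fin.last n else (e i).castSucc := by
    intro i
    show (swap (Fin.last n) p * liftP e) i.castSucc = _
    rw [Perm.mul_apply, liftP_castSucc]
    split_ifs with h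
    · rw [h, swap_apply_right]
    · exact swap_apply_of_ne_of_ne (Fin.castSucc_lt_last _).ne h
  rw [Fin.forall_fin_succ', insP_last, and_comm]
  refine and_congr_right fun hp => forall_congr' fun i => ?_
  replace hp : n ≤ p + k := hp
  rw [hval]
  have hi := i.isLt
  split_ifs with h
  · have h2 : ((e i : Fin n) : ℕ) = p := by rw [← h]; rfl
    rw [h2, Fin.val_last, Fin.val_castSucc]
    omega
  · rfl

theorem sum_factor (n k : ℕ) (q t : MvPolynomial (Fin 2) ℤ) :
    ∑ i : Fin n, (if n ≤ (i : ℕ) + k then q ^ (n - (i : ℕ)) else 0) + 1 =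
      ∑ j ∈ Finset.range (min n k + 1), q ^ j := by
  rw [Finset.sum_range_succ', pow_zero]
  congr 1
  rw [Fin.sum_univ_eq_sum_range (fun i => if n ≤ i + k then q ^ (n - i) else 0) n,
    ← Finset.sum_range_reflect, ← Finset.sum_filter_add_sum_filter_not _ (fun j => j < k)]
  rw [Finset.sum_congr rfl (g := fun j => q ^ (j + 1)), Finset.sum_eq_zero (s := Finset.filter (fun j => ¬ j < k) _), add_zero]
  · apply Finset.sum_congr _ fun _ _ => rfl
    ext j; simp
  · intro j hj
    simp only [Finset.mem_filter, Finset.mem_range] at hj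
    rw [if_neg (by omega)]
  · intro j hj
    simp only [Finset.mem_filter, Finset.mem_range] at hj
    rw [if_pos (by omega)]
    congr 1; omega

theorem main_aux (n k : ℕ) :
    ∑ σ ∈ bddA n k,
        (MvPolynomial.X 0 : MvPolynomial (Fin 2) ℤ) ^ DIS σ *
          MvPolynomial.X 1 ^ cycStat σ =
      ∏ i ∈ Finset.range n, (MvPolynomial.X 1 + qBracket (min i k + 1) - 1) := by
  induction n with
  | zero =>
    have h0 : bddA 0 k = {1} := by
      ext σ
      rw [mem_bddA]
      simp [Subsingleton.elim σ 1]
    have h1 : DIS (1 : Perm (Fin 0)) = 0 := by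
      have := sorStat_eq ([] : List (Fin 0 × Fin 0)) ⟨by simp, List.isChain_nil⟩
      unfold DIS
      rw [inv_one]
      exact this
    rw [h0, Finset.sum_singleton, h1]
    simp [cycStat]
  | succ n ih =>
    rw [Finset.prod_range_succ, ← ih]
    have hb : ∀ m, ∀ f : Perm (Fin m) → MvPolynomial (Fin 2) ℤ, ∑ σ ∈ bddA m k, f σ =
        ∑ σ, if σ ∈ bddA m k then f σ else 0 := by
      intro m f
      rw [← Finset.sum_filter]
      congr 1
      ext; simp
    rw [hb, hb, ← insP_bijective.sum_comp, Fintype.sum_prod_type, Fin.sum_univ_castSucc]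
    have hf := sum_factor n k (MvPolynomial.X 0) (MvPolynomial.X 1)
    have hq : qBracket (min n k + 1) = _ := hf.symm
    rw [hq, show ∀ a b : MvPolynomial (Fin 2) ℤ, a + (b + 1) - 1 = b + a by intros; ring,
      mul_add, Finset.mul_sum]
    congr 1
    · refine Finset.sum_congr rfl fun i _ => ?_
      rw [Finset.sum_mul]
      refine Finset.sum_congr rfl fun e _ => ?_
      rw [DIS_insP_castSucc, cycStat_insP_castSucc]
      simp only [insP_mem, Fin.val_castSucc]
      by_cases h1 : n ≤ (i : ℕ) + k <;> by_cases h2 : e ∈ bddA n k <;> simp [h1, h2]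
      ring
    · rw [Finset.sum_mul]
      refine Finset.sum_congr rfl fun e _ => ?_
      rw [DIS_insP_last, cycStat_insP_last]
      simp only [insP_mem, Fin.val_last]
      by_cases h2 : e ∈ bddA n k <;> simp [h2]
      ring

end Helpers

/-- the joint generating function of `(DIS, cyc)` over `A(n,k)`,
in `ℤ[q,t]` with `q = X 0`, `t = X 1`. -/
theorem stmt2 (n k : ℕ) (hn : 1 ≤ n) (hk0 : 0 < k) (hk : k ≤ n) :
    ∑ σ ∈ bddA n k,
        (MvPolynomial.X 0 : MvPolynomial (Fin 2) ℤ) ^ DIS σ *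
          MvPolynomial.X 1 ^ cycStat σ =
      (MvPolynomial.X 1 + qBracket (k + 1) - 1) ^ (n - k) *
        ∏ i ∈ Finset.Icc 1 k, (MvPolynomial.X 1 + qBracket i - 1) := by
  rw [main_aux]
  obtain ⟨m, rfl⟩ := Nat.exists_eq_add_of_le hk
  rw [Finset.prod_range_add, Nat.add_sub_cancel_left, mul_comm]
  congr 1
  · rw [Finset.prod_congr rfl (g := fun _ => MvPolynomial.X 1 + qBracket (k + 1) - 1)]
    · simp
    · intro i _
      rw [min_eq_right (by omega)]
  · symm
    refine Finset.prod_bij' (fun i _ => i - 1) (fun i _ => i + 1) ?_ ?_ ?_ ?_ ?_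
    · intro i hi
      simp only [Finset.mem_Icc, Finset.mem_range] at *
      omega
    · intro i hi
      simp only [Finset.mem_Icc, Finset.mem_range] at *
      omega
    · intro i hi
      simp only [Finset.mem_Icc] at *
      omega
    · intro i hi
      simp
    · intro i hi
      simp only [Finset.mem_Icc] at hi
      rw [show min (i - 1) k + 1 = i by omega]
end

section
/- For all integers n ≥ 0 and 0 ≤ k ≤ n, the number of 213-avoiding permutations in A(n,k) equals the ballot number C_{n,k} = ((n−k+1)/(n+1))·binom(n+k, k); that is, #A_{n,k}(213) = C_{n,k}. -/
attribute [local instance] Classical.propDecidable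

/-- For 213-avoiders the maximum drop is attained at the last position. -/
lemma maxdrop_le_iff_s8 {n k : ℕ} (π : Equiv.Perm (Fin (n + 1))) (h : avoids213 π) :
    maxdrop π ≤ k ↔ n ≤ (π (Fin.last n) : ℕ) + k := by
  unfold maxdrop
  rw [Finset.sup_le_iff]
  constructor
  · intro H
    have := H (Fin.last n) (Finset.mem_univ _)
    simp only [Fin.val_last] at this
    omega
  · intro H i _
    have key : (π (Fin.last n) : ℕ) - (π i : ℕ) ≤ n - (i : ℕ) := by
      have hc : (Finset.Ioc (π i) (π (Fin.last n))).card
          ≤ (Finset.Ioc i (Fin.last n)).card := by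
        apply Finset.card_le_card_of_injOn (fun v => π.symm v)
        · intro v hv
          simp only [Finset.coe_Ioc, Set.mem_Ioc] at hv ⊢
          refine ⟨?_, Fin.le_last _⟩
          by_contra hlt
          rw [not_lt] at hlt
          have hne : π.symm v ≠ i := by
            rintro rfl
            simp at hv
          have hlt' : π.symm v < i := lt_of_le_of_ne hlt hne
          have hil : i ≠ Fin.last n := by
            rintro rfl
            exact absurd (lt_of_lt_of_le hv.1 hv.2) (lt_irrefl _)
          have hvl : v ≠ π (Fin.last n) := by
            rintro rfl
            simp only [Equiv.symm_apply_apply] at hlt'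
            exact absurd hlt' (not_lt.mpr (Fin.le_last _))
          exact h ⟨π.symm v, i, Fin.last n, hlt', lt_of_le_of_ne (Fin.le_last _) hil,
            by simpa using hv.1, by simpa using lt_of_le_of_ne hv.2 hvl⟩
        · exact fun a _ b _ hab => π.symm.injective hab
      simpa using hc
    have hi := i.isLt
    omega

/-- Append the value `v` at the end of `σ`. -/
def appendPerm {n : ℕ} (v : Fin (n + 1)) (σ : Equiv.Perm (Fin n)) :
    Equiv.Perm (Fin (n + 1)) :=
  ((finSuccEquiv' (Fin.last n)).trans σ.optionCongr).trans (finSuccEquiv' v).symm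

lemma appendPerm_last {n : ℕ} (v : Fin (n + 1)) (σ : Equiv.Perm (Fin n)) :
    appendPerm v σ (Fin.last n) = v := by
  simp [appendPerm]

lemma appendPerm_castSucc {n : ℕ} (v : Fin (n + 1)) (σ : Equiv.Perm (Fin n)) (i : Fin n) :
    appendPerm v σ i.castSucc = v.succAbove (σ i) := by
  have : finSuccEquiv' (Fin.last n) i.castSucc = some i := by
    rw [← Fin.succAbove_last_apply, finSuccEquiv'_succAbove]
  simp [appendPerm, this]

lemma appendPerm_injective {n : ℕ} (v : Fin (n + 1)) :
    Function.Injective (appendPerm v) := by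
  intro σ ρ h
  ext i
  have := congrArg (fun τ => τ i.castSucc) h
  simp only [appendPerm_castSucc] at this
  rw [Fin.succAbove_right_injective this]

lemma appendPerm_surj {n : ℕ} (τ : Equiv.Perm (Fin (n + 1))) :
    ∃ σ, appendPerm (τ (Fin.last n)) σ = τ := by
  have hx : ∀ i : Fin n, ∃ w, (τ (Fin.last n)).succAbove w = τ i.castSucc := by
    intro i
    apply Fin.exists_succAbove_eq
    intro h
    exact (Fin.castSucc_lt_last i).ne (τ.injective h)
  choose s hs using hx
  have hinj : Function.Injective s := by
    intro a b hab
    have : τ a.castSucc = τ b.castSucc := by rw [← hs, ← hs, hab]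
    exact Fin.castSucc_injective _ (τ.injective this)
  refine ⟨Equiv.ofBijective s (Finite.injective_iff_bijective.mp hinj), ?_⟩
  ext i
  induction i using Fin.lastCases with
  | last => rw [appendPerm_last]
  | cast i => rw [appendPerm_castSucc, Equiv.ofBijective_apply, hs]

lemma avoids_appendPerm {n : ℕ} (v : Fin (n + 2)) (σ : Equiv.Perm (Fin (n + 1))) :
    avoids213 (appendPerm v σ) ↔
      avoids213 σ ∧ (v : ℕ) ≤ (σ (Fin.last n) : ℕ) + 1 := by
  constructor
  · intro h
    constructor
    · rintro ⟨i, j, l, hij, hjl, h1, h2⟩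
      refine h ⟨i.castSucc, j.castSucc, l.castSucc, by simpa using hij, by simpa using hjl, ?_, ?_⟩
      · simpa only [appendPerm_castSucc, Fin.succAbove_lt_succAbove_iff] using h1
      · simpa only [appendPerm_castSucc, Fin.succAbove_lt_succAbove_iff] using h2
    · by_contra hv
      rw [not_le] at hv
      have hvl := v.isLt
      let w : Fin (n + 1) := ⟨(σ (Fin.last n) : ℕ) + 1, by omega⟩
      have hlw : σ (Fin.last n) < w := by
        rw [Fin.lt_def]
        simp [w]
      have hwl : σ.symm w ≠ Fin.last n := by
        intro hw
        rw [← hw] at hlw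
        simp at hlw
      refine h ⟨(σ.symm w).castSucc, (Fin.last n).castSucc, Fin.last (n + 1), ?_, ?_, ?_, ?_⟩
      · simpa using lt_of_le_of_ne (Fin.le_last _) hwl
      · exact Fin.castSucc_lt_last _
      · simpa only [appendPerm_castSucc, Fin.succAbove_lt_succAbove_iff,
          Equiv.apply_symm_apply] using hlw
      · rw [appendPerm_castSucc, appendPerm_last, Equiv.apply_symm_apply,
          Fin.succAbove_lt_iff_castSucc_lt, Fin.lt_def]
        simpa [w] using hv
  · rintro ⟨h, hv⟩ ⟨i, j, l, hij, hjl, h1, h2⟩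
    obtain ⟨j, rfl⟩ := Fin.exists_castSucc_eq.mpr (lt_of_lt_of_le hjl (Fin.le_last _)).ne
    obtain ⟨i, rfl⟩ := Fin.exists_castSucc_eq.mpr
      (lt_of_lt_of_le (hij.trans hjl) (Fin.le_last _)).ne
    rw [appendPerm_castSucc, appendPerm_castSucc, Fin.succAbove_lt_succAbove_iff] at h1
    rw [Fin.castSucc_lt_castSucc_iff] at hij
    induction l using Fin.lastCases with
    | last =>
      rw [appendPerm_castSucc, appendPerm_last, Fin.succAbove_lt_iff_castSucc_lt,
        Fin.lt_def] at h2
      have hle : σ i ≤ σ (Fin.last n) := by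
        rw [Fin.le_def]
        simp only [Fin.val_castSucc] at h2
        omega
      have hil : i ≠ Fin.last n := (lt_of_lt_of_le hij (Fin.le_last _)).ne
      have hlt : σ i < σ (Fin.last n) := lt_of_le_of_ne hle (fun e => hil (σ.injective e))
      have hjne : j ≠ Fin.last n := by
        rintro rfl
        exact absurd (h1.trans hlt) (lt_irrefl _)
      exact h ⟨i, j, Fin.last n, hij, lt_of_le_of_ne (Fin.le_last _) hjne, h1, hlt⟩
    | cast l =>
      rw [appendPerm_castSucc, appendPerm_castSucc, Fin.succAbove_lt_succAbove_iff] at h2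
      rw [Fin.castSucc_lt_castSucc_iff] at hjl
      exact h ⟨i, j, l, hij, hjl, h1, h2⟩

/-- 213-avoiders of length `n + 1` whose last value is at least `n - k`. -/
noncomputable def Bset (n k : ℕ) : Finset (Equiv.Perm (Fin (n + 1))) :=
  Finset.univ.filter fun π => avoids213 π ∧ n ≤ (π (Fin.last n) : ℕ) + k

lemma filter_bddA (n k : ℕ) :
    ((bddA (n + 1) k).filter fun π => avoids213 π) = Bset n k := by
  ext π
  simp only [bddA, Bset, Finset.mem_filter, Finset.mem_univ, true_and]
  constructor
  · rintro ⟨h1, h2⟩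
    exact ⟨h2, (maxdrop_le_iff_s8 π h2).mp h1⟩
  · rintro ⟨h1, h2⟩
    exact ⟨(maxdrop_le_iff_s8 π h1).mpr h2, h1⟩

lemma card_last_eq (n : ℕ) (v : Fin (n + 2)) :
    (Finset.univ.filter fun π : Equiv.Perm (Fin (n + 2)) =>
      avoids213 π ∧ π (Fin.last (n + 1)) = v).card = (Bset n (n + 1 - v)).card := by
  symm
  apply Finset.card_bij (fun σ _ => appendPerm v σ)
  · intro σ hσ
    simp only [Bset, Finset.mem_filter, Finset.mem_univ, true_and] at hσ ⊢
    refine ⟨(avoids_appendPerm v σ).mpr ⟨hσ.1, ?_⟩, appendPerm_last v σ⟩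
    have := v.isLt
    omega
  · intro a _ b _ hab
    exact appendPerm_injective v hab
  · intro τ hτ
    simp only [Finset.mem_filter, Finset.mem_univ, true_and] at hτ
    obtain ⟨h1, rfl⟩ := hτ
    obtain ⟨σ, hσ⟩ := appendPerm_surj τ
    refine ⟨σ, ?_, hσ⟩
    rw [← hσ, avoids_appendPerm] at h1
    simp only [Bset, Finset.mem_filter, Finset.mem_univ, true_and]
    refine ⟨h1.1, ?_⟩
    have := h1.2
    have := (τ (Fin.last (n + 1))).isLt
    omega

lemma Bset_zero_left (k : ℕ) : (Bset 0 k).card = 1 := by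
  have : Bset 0 k = Finset.univ := by
    ext π
    simp only [Bset, Finset.mem_filter, Finset.mem_univ, true_and, iff_true]
    refine ⟨?_, Nat.zero_le _⟩
    rintro ⟨i, j, l, hij, -⟩
    rw [Fin.lt_def] at hij
    have := j.isLt
    omega
  rw [this]
  simp

lemma Bset_zero_right (n : ℕ) : (Bset n 0).card = 1 := by
  induction n with
  | zero => exact Bset_zero_left 0
  | succ n ih =>
    have := card_last_eq n (Fin.last (n + 1))
    simp only [Fin.val_last, Nat.sub_self] at this
    refine Eq.trans ?_ (this.trans ih)
    congr 1
    ext π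
    simp only [Bset, Finset.mem_filter, Finset.mem_univ, true_and, Fin.ext_iff, Fin.val_last]
    have := (π (Fin.last (n + 1))).isLt
    constructor
    · rintro ⟨h1, h2⟩
      exact ⟨h1, by omega⟩
    · rintro ⟨h1, h2⟩
      exact ⟨h1, by omega⟩

lemma Bset_rec (n k : ℕ) (hk : k ≤ n) :
    (Bset (n + 1) (k + 1)).card = (Bset (n + 1) k).card + (Bset n (k + 1)).card := by
  have h := card_last_eq n ⟨n - k, by omega⟩
  have e : n + 1 - (n - k) = k + 1 := by omega
  simp only [e] at h
  rw [← h, ← Finset.card_union_of_disjoint]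
  · congr 1
    ext π
    simp only [Bset, Finset.mem_filter, Finset.mem_univ, true_and, Finset.mem_union, Fin.ext_iff]
    rw [← and_or_left]
    apply and_congr_right
    intro _
    omega
  · rw [Finset.disjoint_left]
    intro π
    simp only [Bset, Finset.mem_filter, Finset.mem_univ, true_and, Fin.ext_iff]
    rintro ⟨_, h1⟩ ⟨_, h2⟩
    omega

lemma Bset_top (n k : ℕ) (hk : n ≤ k) : (Bset n k).card = (Bset n n).card := by
  congr 1
  ext π
  simp only [Bset, Finset.mem_filter, Finset.mem_univ, true_and]
  apply and_congr_right
  intro _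
  omega

/-- The count in multiplied-out form. -/
lemma Bset_card (n : ℕ) : ∀ k, k ≤ n + 1 →
    ((Bset n k).card : ℚ) =
      (((n + 1 : ℕ) : ℚ) - (k : ℚ) + 1) / (((n + 1 : ℕ) : ℚ) + 1) * ((n + 1 + k).choose k : ℚ) := by
  induction n with
  | zero =>
    intro k hk
    rw [Bset_zero_left]
    interval_cases k <;> norm_num
  | succ n ih =>
    have aux : ∀ k, k ≤ n + 1 → ((Bset (n + 1) k).card : ℚ) =
      (((n + 1 + 1 : ℕ) : ℚ) - (k : ℚ) + 1) / (((n + 1 + 1 : ℕ) : ℚ) + 1) *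
        ((n + 1 + 1 + k).choose k : ℚ) := by
      intro k
      induction k with
      | zero =>
        intro _
        rw [Bset_zero_right]
        push_cast
        simp
        field_simp
      | succ k ihk =>
        intro hk
        rw [Bset_rec n k (by omega)]
        rw [Nat.cast_add, ihk (by omega), ih (k + 1) hk]
        have e1 : n + 1 + (k + 1) = n + 2 + k := by ring
        have e2 : n + 1 + 1 + (k + 1) = (n + 2 + k) + 1 := by ring
        have e3 : n + 1 + 1 + k = n + 2 + k := by ring
        rw [e1, e2, e3, Nat.choose_succ_succ]
        have hr := Nat.choose_succ_right_eq (n + 2 + k) k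
        rw [Nat.add_sub_cancel] at hr
        have hq : ((n + 2 + k).choose (k + 1) : ℚ) =
            ((n + 2 + k).choose k : ℚ) * ((n : ℚ) + 2) / ((k : ℚ) + 1) := by
          rw [eq_div_iff (by positivity)]
          exact_mod_cast hr
        push_cast
        rw [hq]
        field_simp
        ring
    intro k hk
    rcases Nat.lt_or_ge k (n + 2) with h | h
    · exact aux k (by omega)
    · obtain rfl : k = n + 2 := by omega
      rw [Bset_top _ _ (by omega), aux (n + 1) le_rfl]
      have e1 : n + 1 + 1 + (n + 1) = 2 * n + 3 := by ring
      have e2 : n + 1 + 1 + (n + 2) = (2 * n + 3) + 1 := by ring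
      rw [e1, e2, Nat.choose_succ_succ (2 * n + 3) (n + 1)]
      have hr : (2 * n + 3).choose (n + 1).succ = (2 * n + 3).choose (n + 1) :=
        Nat.choose_symm_of_eq_add (by rw [Nat.succ_eq_add_one]; ring)
      rw [hr]
      push_cast
      field_simp
      ring

/-- `#A_{n,k}(213) = C_{n,k} = ((n-k+1)/(n+1))·binom(n+k,k)`. -/
theorem stmt8 (n k : ℕ) (hk : k ≤ n) :
    (((bddA n k).filter fun π => avoids213 π).card : ℚ) =
      ((n : ℚ) - (k : ℚ) + 1) / ((n : ℚ) + 1) * ((n + k).choose k : ℚ) := by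
  cases n with
  | zero =>
    obtain rfl : k = 0 := by omega
    have : ((bddA 0 0).filter fun π => avoids213 π) = Finset.univ := by
      ext π
      simp [bddA, maxdrop, avoids213]
    rw [this]
    simp
  | succ n =>
    rw [filter_bddA]
    exact Bset_card n k hk
end
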